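/- Fix \tau \in [0,1). Then \lim_{x \to \infty} \phi_s(x;\tau) / x^3 = (\pi^2/48) \cdot (1-\tau)/(1+\tau). -/

import Mathlib

open Real Set MeasureTheory Filter

/-- `Ψ_s(z;τ) = √((1+τ)/((1-τ)·2π)) · (2/√π) ∫_0^∞ log(1 - (1-z) e^{-t²}) dt`. -/
noncomputable def PsiS (τ z : ℝ) : ℝ :=
  Real.sqrt ((1 + τ) / ((1 - τ) * (2 * Real.pi))) *
    ((2 / Real.sqrt Real.pi) *
      ∫ t in Set.Ioi (0 : ℝ), Real.log (1 - (1 - z) * Real.exp (-t ^ 2)))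

/-- `φ_s(x;τ) = sup_{u ∈ ℝ} { (x/2) u - Ψ_s(e^u;τ) }`. -/
noncomputable def phiS (τ x : ℝ) : ℝ :=
  ⨆ u : ℝ, ((x / 2) * u - PsiS τ (Real.exp u))

/-- The integrand of `PsiS` at `z = e^u` is at least `u e^{-t²}`, by concavity of `log`. -/
lemma mul_exp_neg_sq_le_log (u t : ℝ) :
    u * exp (-t ^ 2) ≤ log (1 - (1 - exp u) * exp (-t ^ 2)) := by
  have he : exp (-t ^ 2) ≤ 1 := exp_le_one_iff.2 (by nlinarith [sq_nonneg t])
  have hc := strictConcaveOn_log_Ioi.concaveOn.2 (mem_Ioi.2 one_pos) (mem_Ioi.2 (exp_pos u))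
    (sub_nonneg.2 he) (exp_pos (-t ^ 2)).le (by ring)
  simp only [smul_eq_mul, log_one, mul_zero, zero_add, log_exp] at hc
  calc u * exp (-t ^ 2) = exp (-t ^ 2) * u := mul_comm _ _
    _ ≤ _ := hc
    _ = _ := by congr 1; ring

lemma one_sub_mul_exp_neg_sq_pos (u t : ℝ) : 0 < 1 - (1 - exp u) * exp (-t ^ 2) := by
  have he : exp (-t ^ 2) ≤ 1 := exp_le_one_iff.2 (by nlinarith [sq_nonneg t])
  nlinarith [mul_pos (exp_pos u) (exp_pos (-t ^ 2))]

lemma log_le_mul_exp_neg_sq (u t : ℝ) :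
    log (1 - (1 - exp u) * exp (-t ^ 2)) ≤ (exp u - 1) * exp (-t ^ 2) := by
  linarith [log_le_sub_one_of_pos (one_sub_mul_exp_neg_sq_pos u t)]

lemma sub_sq_le_log (u t : ℝ) : u - t ^ 2 ≤ log (1 - (1 - exp u) * exp (-t ^ 2)) := by
  have he : exp (-t ^ 2) ≤ 1 := exp_le_one_iff.2 (by nlinarith [sq_nonneg t])
  rw [le_log_iff_exp_le (one_sub_mul_exp_neg_sq_pos u t), sub_eq_add_neg, exp_add]
  linarith

lemma log_le_sub_sq_add_log_two {u t : ℝ} (h : t ^ 2 ≤ u) :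
    log (1 - (1 - exp u) * exp (-t ^ 2)) ≤ u - t ^ 2 + log 2 := by
  have h1 : 1 ≤ exp (u - t ^ 2) := one_le_exp (sub_nonneg.2 h)
  have h2 : exp u * exp (-t ^ 2) = exp (u - t ^ 2) := by rw [← exp_add, ← sub_eq_add_neg]
  rw [log_le_iff_le_exp (one_sub_mul_exp_neg_sq_pos u t), exp_add, exp_log two_pos]
  linarith [exp_pos (-t ^ 2)]

lemma log_le_exp_neg_sub_sq {s t : ℝ} (hs : 0 ≤ s) (h : s ≤ t) :
    log (1 - (1 - exp (s ^ 2)) * exp (-t ^ 2)) ≤ exp (-1 * (t - s) ^ 2) := by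
  have h2 : exp (s ^ 2) * exp (-t ^ 2) ≤ exp (-1 * (t - s) ^ 2) := by
    rw [← exp_add]
    exact exp_le_exp.2 (by nlinarith)
  linarith [log_le_mul_exp_neg_sq (s ^ 2) t, exp_pos (-t ^ 2)]

lemma integrable_exp_neg_sq : Integrable fun t : ℝ => exp (-t ^ 2) := by
  simpa using integrable_exp_neg_mul_sq (b := 1) one_pos

lemma integrable_log_one_sub_mul_exp_neg_sq (u : ℝ) :
    Integrable fun t : ℝ => log (1 - (1 - exp u) * exp (-t ^ 2)) := by
  refine (integrable_exp_neg_sq.const_mul (|u| + |exp u - 1|)).mono'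
    (Continuous.aestronglyMeasurable ?_) (Eventually.of_forall fun t => ?_)
  · exact Continuous.log (by fun_prop) fun t => (one_sub_mul_exp_neg_sq_pos u t).ne'
  · have he := exp_pos (-t ^ 2)
    rw [norm_eq_abs, abs_le]
    constructor
    · nlinarith [mul_exp_neg_sq_le_log u t, neg_abs_le u, abs_nonneg (exp u - 1)]
    · nlinarith [log_le_mul_exp_neg_sq u t, le_abs_self (exp u - 1), abs_nonneg u]

lemma mul_sqrt_pi_le_integral_log (u : ℝ) :
    u * (√π / 2) ≤ ∫ t in Ioi (0 : ℝ), log (1 - (1 - exp u) * exp (-t ^ 2)) := by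
  have h : ∫ t in Ioi (0 : ℝ), exp (-t ^ 2) = √π / 2 := by
    simpa using integral_gaussian_Ioi 1
  rw [← h, ← integral_const_mul]
  exact integral_mono (integrable_exp_neg_sq.integrableOn.const_mul u)
    (integrable_log_one_sub_mul_exp_neg_sq u).integrableOn (mul_exp_neg_sq_le_log u)

lemma setIntegral_Ioc_sq_sub_sq_add {s : ℝ} (hs : 0 ≤ s) (c : ℝ) :
    ∫ t in Ioc 0 s, (s ^ 2 - t ^ 2 + c) = 2 / 3 * s ^ 3 + c * s := by
  rw [← intervalIntegral.integral_of_le hs, intervalIntegral.integral_add,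
    intervalIntegral.integral_sub, integral_pow]
  · simp only [intervalIntegral.integral_const, smul_eq_mul]
    ring
  all_goals exact Continuous.intervalIntegrable (by fun_prop) _ _

lemma integrableOn_Ioc_sq_sub_sq_add (s c : ℝ) :
    IntegrableOn (fun t : ℝ => s ^ 2 - t ^ 2 + c) (Ioc 0 s) :=
  (Continuous.integrableOn_Icc (by fun_prop)).mono_set Ioc_subset_Icc_self

lemma le_integral_log_exp_sq {s : ℝ} (hs : 0 ≤ s) :
    2 / 3 * s ^ 3 ≤ ∫ t in Ioi (0 : ℝ), log (1 - (1 - exp (s ^ 2)) * exp (-t ^ 2)) := by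
  have hi := integrable_log_one_sub_mul_exp_neg_sq (s ^ 2)
  calc 2 / 3 * s ^ 3 = ∫ t in Ioc 0 s, (s ^ 2 - t ^ 2 + 0) := by
        rw [setIntegral_Ioc_sq_sub_sq_add hs]; ring
    _ ≤ ∫ t in Ioc 0 s, log (1 - (1 - exp (s ^ 2)) * exp (-t ^ 2)) :=
        integral_mono (integrableOn_Ioc_sq_sub_sq_add s 0) hi.integrableOn
          fun t => by simpa using sub_sq_le_log (s ^ 2) t
    _ ≤ _ := setIntegral_mono_set hi.integrableOn
          (Eventually.of_forall fun t =>
            (mul_nonneg (sq_nonneg s) (exp_pos _).le).trans (mul_exp_neg_sq_le_log (s ^ 2) t))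
          Ioc_subset_Ioi_self.eventuallyLE

lemma integral_log_exp_sq_le {s : ℝ} (hs : 0 ≤ s) :
    ∫ t in Ioi (0 : ℝ), log (1 - (1 - exp (s ^ 2)) * exp (-t ^ 2)) ≤
      2 / 3 * s ^ 3 + log 2 * s + √π := by
  have hi := integrable_log_one_sub_mul_exp_neg_sq (s ^ 2)
  have hg : Integrable fun t : ℝ => exp (-1 * (t - s) ^ 2) :=
    (integrable_exp_neg_mul_sq one_pos).comp_sub_right s
  rw [← Ioc_union_Ioi_eq_Ioi hs, setIntegral_union (Ioc_disjoint_Ioi le_rfl) measurableSet_Ioi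
    hi.integrableOn hi.integrableOn, ← setIntegral_Ioc_sq_sub_sq_add hs]
  refine add_le_add ?_ ?_
  · refine setIntegral_mono_on hi.integrableOn (integrableOn_Ioc_sq_sub_sq_add s _)
      measurableSet_Ioc fun t ht => log_le_sub_sq_add_log_two ?_
    exact pow_le_pow_left₀ ht.1.le ht.2 2
  · calc ∫ t in Ioi s, log (1 - (1 - exp (s ^ 2)) * exp (-t ^ 2))
        ≤ ∫ t in Ioi s, exp (-1 * (t - s) ^ 2) :=
          setIntegral_mono_on hi.integrableOn hg.integrableOn measurableSet_Ioi
            fun t ht => log_le_exp_neg_sub_sq hs (le_of_lt ht)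
      _ ≤ ∫ t, exp (-1 * (t - s) ^ 2) :=
          setIntegral_le_integral hg (Eventually.of_forall fun t => (exp_pos _).le)
      _ = √π := by
          rw [integral_sub_right_eq_self (fun t : ℝ => exp (-1 * t ^ 2)) s]
          simpa using integral_gaussian 1

/-- The constant in front of the integral in `PsiS`. -/
noncomputable def psiSCoeff (τ : ℝ) : ℝ :=
  √((1 + τ) / ((1 - τ) * (2 * π))) * (2 / √π)

lemma PsiS_eq_psiSCoeff_mul (τ z : ℝ) :
    PsiS τ z = psiSCoeff τ * ∫ t in Ioi (0 : ℝ), log (1 - (1 - z) * exp (-t ^ 2)) := by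
  rw [PsiS, psiSCoeff, mul_assoc]

lemma psiSCoeff_pos {τ : ℝ} (hτ0 : 0 ≤ τ) (hτ1 : τ < 1) : 0 < psiSCoeff τ := by
  have := sub_pos.2 hτ1
  unfold psiSCoeff
  positivity

lemma one_div_mul_psiSCoeff_sq {τ : ℝ} (hτ0 : 0 ≤ τ) (hτ1 : τ < 1) :
    1 / (24 * psiSCoeff τ ^ 2) = π ^ 2 / 48 * ((1 - τ) / (1 + τ)) := by
  have h1 := sub_pos.2 hτ1
  have h2 : 0 < 1 + τ := by linarith
  rw [psiSCoeff, mul_pow, div_pow, sq_sqrt (by positivity), sq_sqrt pi_pos.le]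
  have := pi_pos
  field_simp
  norm_num

lemma mul_sub_PsiS_le {τ x : ℝ} (hτ0 : 0 ≤ τ) (hτ1 : τ < 1) (hx : psiSCoeff τ * √π ≤ x) (u : ℝ) :
    x / 2 * u - PsiS τ (exp u) ≤ 1 / (24 * psiSCoeff τ ^ 2) * x ^ 3 := by
  have hD := psiSCoeff_pos hτ0 hτ1
  rw [PsiS_eq_psiSCoeff_mul]
  set D := psiSCoeff τ
  have hx0 : 0 ≤ x := le_trans (by positivity) hx
  rcases le_total u 0 with hu | hu
  · have h := mul_le_mul_of_nonneg_left (mul_sqrt_pi_le_integral_log u) hD.le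
    have h0 : 0 ≤ 1 / (24 * D ^ 2) * x ^ 3 := by positivity
    nlinarith
  · obtain ⟨s, hs, rfl⟩ : ∃ s, 0 ≤ s ∧ u = s ^ 2 := ⟨√u, sqrt_nonneg u, (sq_sqrt hu).symm⟩
    have h := mul_le_mul_of_nonneg_left (le_integral_log_exp_sq hs) hD.le
    have hcubic : x / 2 * s ^ 2 - D * (2 / 3 * s ^ 3) ≤ 1 / (24 * D ^ 2) * x ^ 3 := by
      have h0 : 0 ≤ (x - 2 * D * s) ^ 2 * (x + 2 * (2 * D * s)) := by positivity
      rw [one_div_mul_eq_div, le_div_iff₀ (by positivity)]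
      linarith
    linarith

lemma phiS_le {τ x : ℝ} (hτ0 : 0 ≤ τ) (hτ1 : τ < 1) (hx : psiSCoeff τ * √π ≤ x) :
    phiS τ x ≤ 1 / (24 * psiSCoeff τ ^ 2) * x ^ 3 :=
  ciSup_le (mul_sub_PsiS_le hτ0 hτ1 hx)

lemma le_phiS {τ x : ℝ} (hτ0 : 0 ≤ τ) (hτ1 : τ < 1) (hx : psiSCoeff τ * √π ≤ x) :
    1 / (24 * psiSCoeff τ ^ 2) * x ^ 3 - (log 2 / 2 * x + psiSCoeff τ * √π) ≤ phiS τ x := by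
  have hD := psiSCoeff_pos hτ0 hτ1
  have hx0 : 0 ≤ x := le_trans (by positivity) hx
  have hbdd : BddAbove (range fun u : ℝ => x / 2 * u - PsiS τ (exp u)) :=
    ⟨_, forall_mem_range.2 (mul_sub_PsiS_le hτ0 hτ1 hx)⟩
  refine le_trans ?_ (le_ciSup hbdd ((x / (2 * psiSCoeff τ)) ^ 2))
  simp only [PsiS_eq_psiSCoeff_mul]
  set D := psiSCoeff τ
  have hs : 0 ≤ x / (2 * D) := by positivity
  have h := mul_le_mul_of_nonneg_left (integral_log_exp_sq_le hs) hD.le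
  have heq : 1 / (24 * D ^ 2) * x ^ 3 - (log 2 / 2 * x + D * √π) = x / 2 * (x / (2 * D)) ^ 2 -
      D * (2 / 3 * (x / (2 * D)) ^ 3 + log 2 * (x / (2 * D)) + √π) := by
    field_simp
    ring
  linarith

/-- **Cubic growth of the strong-asymmetry rate function.** For `τ ∈ [0,1)`,
`φ_s(x;τ)/x³ → (π²/48)·(1-τ)/(1+τ)` as `x → ∞`. -/
theorem phiS_cubic_growth (τ : ℝ) (hτ0 : 0 ≤ τ) (hτ1 : τ < 1) :
    Tendsto (fun x : ℝ => phiS τ x / x ^ 3) atTop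
      (nhds ((π ^ 2 / 48) * ((1 - τ) / (1 + τ)))) := by
  rw [← one_div_mul_psiSCoeff_sq hτ0 hτ1]
  set L := 1 / (24 * psiSCoeff τ ^ 2)
  set c := psiSCoeff τ * √π
  have hlow : Tendsto (fun x : ℝ => L - (log 2 / 2 * x⁻¹ ^ 2 + c * x⁻¹ ^ 3)) atTop (nhds L) := by
    have h := tendsto_inv_atTop_zero (𝕜 := ℝ)
    simpa using (((h.pow 2).const_mul (log 2 / 2)).add ((h.pow 3).const_mul c)).const_sub L
  refine tendsto_of_tendsto_of_tendsto_of_le_of_le' hlow tendsto_const_nhds ?_ ?_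
  · filter_upwards [eventually_gt_atTop 0, eventually_ge_atTop c] with x hx0 hx
    rw [le_div_iff₀ (by positivity)]
    have h : L * x ^ 3 - (log 2 / 2 * x + c) ≤ phiS τ x := le_phiS hτ0 hτ1 hx
    refine le_trans (le_of_eq ?_) h
    clear_value L c
    field_simp
  · filter_upwards [eventually_gt_atTop 0, eventually_ge_atTop c] with x hx0 hx
    rw [div_le_iff₀ (by positivity)]
    exact phiS_le hτ0 hτ1 hx
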